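/- arXiv:2602.18758 — 2 statements merged into one kernel-verified Lean document; each statement's English description precedes it below -/
import Mathlib

section
/- (Correctness of 1-D Winograd convolution $F(2,3)$.) Let $G$ be the $4\times 3$ real matrix with rows $(1,0,0)$, $(1/2,1/2,1/2)$, $(1/2,-1/2,1/2)$, $(0,0,1)$; let $B^\top$ be the $4\times 4$ integer matrix with rows $(1,0,-1,0)$, $(0,1,1,0)$, $(0,-1,1,0)$, $(0,1,0,-1)$; and let $A^\top$ be the $2\times 4$ integer matrix with rows $(1,1,1,0)$ and $(0,1,-1,-1)$. Then for all vectors $g \in \mathbb{R}^3$ (the filter) and $d \in \mathbb{R}^4$ (the input tile), $A^\top\big((G g) \odot (B^\top d)\big) = \big(g_0 d_0 + g_1 d_1 + g_2 d_2,\; g_0 d_1 + g_1 d_2 + g_2 d_3\big)$, where $\odot$ denotes element-wise (Hadamard) product of vectors in $\mathbb{R}^4$. -/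
open Matrix

/-- The Winograd `F(2,3)` filter-transformation matrix `G`. -/
noncomputable def winoG : Matrix (Fin 4) (Fin 3) ℝ :=
  !![1, 0, 0;
     1/2, 1/2, 1/2;
     1/2, -1/2, 1/2;
     0, 0, 1]

/-- The Winograd `F(2,3)` input-transformation matrix `Bᵀ`. -/
def winoBt : Matrix (Fin 4) (Fin 4) ℝ :=
  !![1, 0, -1, 0;
     0, 1,  1, 0;
     0, -1, 1, 0;
     0, 1,  0, -1]

/-- The Winograd `F(2,3)` output-transformation matrix `Aᵀ`. -/
def winoAt : Matrix (Fin 2) (Fin 4) ℝ :=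
  !![1, 1,  1,  0;
     0, 1, -1, -1]

/-- Correctness of 1-D Winograd convolution `F(2,3)`:
`Aᵀ((G g) ⊙ (Bᵀ d))` equals the two sliding dot products of the length-3
filter `g` with the length-4 input tile `d`. -/
theorem winograd_F23_1d_correct (g : Fin 3 → ℝ) (d : Fin 4 → ℝ) :
    winoAt.mulVec (fun i => winoG.mulVec g i * winoBt.mulVec d i) =
      ![g 0 * d 0 + g 1 * d 1 + g 2 * d 2,
        g 0 * d 1 + g 1 * d 2 + g 2 * d 3] := by
  ext i
  fin_cases i <;>
    simp [winoAt, winoG, winoBt, Matrix.mulVec, dotProduct, Fin.sum_univ_succ] <;>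
    ring
end

section
/- (Correctness of 2-D Winograd convolution $F(2\times 2, 3\times 3)$.) Let $G$ be the $4\times 3$ real matrix with rows $(1,0,0)$, $(1/2,1/2,1/2)$, $(1/2,-1/2,1/2)$, $(0,0,1)$; let $B^\top$ be the $4\times 4$ integer matrix with rows $(1,0,-1,0)$, $(0,1,1,0)$, $(0,-1,1,0)$, $(0,1,0,-1)$; and let $A^\top$ be the $2\times 4$ integer matrix with rows $(1,1,1,0)$ and $(0,1,-1,-1)$. Then for every $3\times 3$ real matrix $W$ and every $4\times 4$ real matrix $X$, the matrix $Y = A^\top\big[(G W G^\top) \odot (B^\top X B)\big] A$ is the $2\times 2$ valid correlation of $W$ with $X$, i.e. $Y_{i,j} = \sum_{p=0}^{2}\sum_{q=0}^{2} W_{p,q}\, X_{i+p,\, j+q}$ for $i,j \in \{0,1\}$, where $\odot$ denotes element-wise (Hadamard) product of $4\times 4$ matrices. -/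
open Matrix

/-- Correctness of 2-D Winograd convolution `F(2×2, 3×3)`:
`Y = Aᵀ[(G W Gᵀ) ⊙ (Bᵀ X B)] A` is the `2×2` valid correlation of the `3×3`
kernel `W` with the `4×4` tile `X`. -/
theorem winograd_F23_2d_correct (W : Matrix (Fin 3) (Fin 3) ℝ)
    (X : Matrix (Fin 4) (Fin 4) ℝ) (i j : Fin 2) :
    (winoAt * Matrix.hadamard (winoG * W * winoGᵀ) (winoBt * X * winoBtᵀ) *
        winoAtᵀ) i j =
      ∑ p : Fin 3, ∑ q : Fin 3,
        W p q * X ⟨i.val + p.val, by have := i.isLt; have := p.isLt; omega⟩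
          ⟨j.val + q.val, by have := j.isLt; have := q.isLt; omega⟩ := by
  simp only [Matrix.mul_apply, Matrix.hadamard_apply, Matrix.transpose_apply, Fin.sum_univ_three,
    Fin.sum_univ_four]
  fin_cases i <;> fin_cases j <;> simp [winoG, winoBt, winoAt] <;> ring
end
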